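/- There is no universal operator for the complement of the class of Banach–Saks operators: there does not exist a bounded operator U between real Banach spaces such that U is not Banach–Saks and U factors through every operator between Banach spaces that is not Banach–Saks. -/

import Mathlib

/-!
STATEMENT 5: There is no universal operator for the complement of the class of
Banach–Saks operators: there is no bounded operator `U` between real Banach spaces such
that `U` is not Banach–Saks and `U` factors through every operator between Banach spaces
that is not Banach–Saks.
-/

open Filter

/-- A bundled real Banach space. -/
structure BanachSp : Type 1 where
  carrier : Type
  [nacg : NormedAddCommGroup carrier]
  [nsp : NormedSpace ℝ carrier]
  [cs : CompleteSpace carrier]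

attribute [instance] BanachSp.nacg BanachSp.nsp BanachSp.cs

/-- `A` factors through `B`: there are bounded operators `C`, `D` with `A = D ∘ B ∘ C`. -/
def FactorsThrough {X Y Z W : Type*} [NormedAddCommGroup X] [NormedSpace ℝ X]
    [NormedAddCommGroup Y] [NormedSpace ℝ Y] [NormedAddCommGroup Z] [NormedSpace ℝ Z]
    [NormedAddCommGroup W] [NormedSpace ℝ W]
    (A : X →L[ℝ] Y) (B : Z →L[ℝ] W) : Prop :=
  ∃ (C : X →L[ℝ] Z) (D : W →L[ℝ] Y), ∀ x, D (B (C x)) = A x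

/-- An operator `A : X → Y` is Banach–Saks if every bounded sequence in `X` has a
subsequence whose image under `A` is Cesàro summable (the Cesàro means converge in norm). -/
def BanachSaks {X Y : Type*} [NormedAddCommGroup X] [NormedSpace ℝ X]
    [NormedAddCommGroup Y] [NormedSpace ℝ Y] (A : X →L[ℝ] Y) : Prop :=
  ∀ x : ℕ → X, (∃ M : ℝ, ∀ n, ‖x n‖ ≤ M) →
    ∃ φ : ℕ → ℕ, StrictMono φ ∧ ∃ y : Y,
      Tendsto (fun N : ℕ => (N : ℝ)⁻¹ • ∑ k ∈ Finset.range N, A (x (φ k)))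
        atTop (nhds y)

open scoped ENNReal ZeroAtInfty

/-- A uniformly bounded sequence of real sequences has a pointwise convergent subsequence. -/
theorem exists_pointwise_convergent_subseq (b : ℕ → ℕ → ℝ) (M : ℝ) (hb : ∀ n i, |b n i| ≤ M) :
    ∃ φ : ℕ → ℕ, StrictMono φ ∧ ∃ z : ℕ → ℝ,
      ∀ i, Tendsto (fun n => b (φ n) i) atTop (nhds (z i)) := by
  have hK : IsCompact (Set.pi Set.univ fun _ : ℕ => Set.Icc (-M) M) :=
    isCompact_univ_pi fun _ => isCompact_Icc
  obtain ⟨z, -, φ, hφ, h⟩ := hK.tendsto_subseq (x := b) fun n i _ => abs_le.mp (hb n i)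
  exact ⟨φ, hφ, z, fun i => (tendsto_pi_nhds.mp h) i⟩

/-! ### The space `c₀` -/

/-- The identity of `c₀` is not Banach–Saks. -/
theorem not_banachSaks_id_zeroAtInfty :
    ¬ BanachSaks (ContinuousLinearMap.id ℝ C₀(ℕ, ℝ)) := by
  intro h
  let x : ℕ → C₀(ℕ, ℝ) := fun n =>
    { toFun := fun i => if i < n then 1 else 0
      continuous_toFun := continuous_of_discreteTopology
      zero_at_infty' := by
        rw [Filter.cocompact_eq_cofinite, Nat.cofinite_eq_atTop]
        refine tendsto_const_nhds.congr' ?_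
        filter_upwards [eventually_ge_atTop n] with i hi
        simp [hi] }
  have hx : ∀ n i, x n i = if i < n then 1 else 0 := fun _ _ => rfl
  obtain ⟨φ, hφ, y, hy⟩ := h x ⟨1, fun n => by
    rw [← ZeroAtInftyContinuousMap.norm_toBCF_eq_norm]
    refine (BoundedContinuousFunction.norm_le zero_le_one).mpr fun i => ?_
    change ‖x n i‖ ≤ 1
    rw [hx]
    split_ifs <;> simp⟩
  have hy1 : ∀ i, y i = 1 := by
    intro i
    have h1 : Tendsto (fun N : ℕ => (N : ℝ)⁻¹ * ∑ k ∈ Finset.range N, x (φ k) i)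
        atTop (nhds 1) := by
      refine Tendsto.cesaro (tendsto_const_nhds.congr' ?_)
      filter_upwards [eventually_gt_atTop i] with k hk
      rw [hx, if_pos (hk.trans_le (hφ.id_le k))]
    have h2 : Tendsto (fun N : ℕ => (N : ℝ)⁻¹ * ∑ k ∈ Finset.range N, x (φ k) i)
        atTop (nhds (y i)) := by
      rw [tendsto_iff_norm_sub_tendsto_zero] at hy ⊢
      refine squeeze_zero (fun _ => norm_nonneg _) (fun N => ?_) hy
      rw [← ZeroAtInftyContinuousMap.norm_toBCF_eq_norm]
      refine le_trans (le_of_eq ?_) (BoundedContinuousFunction.norm_coe_le_norm _ i)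
      have hsum : ∀ s : Finset ℕ, (∑ k ∈ s, x (φ k)) i = ∑ k ∈ s, x (φ k) i := fun s => by
        induction s using Finset.cons_induction with
        | empty => simp
        | cons a s ha ih => rw [Finset.sum_cons, Finset.sum_cons, ZeroAtInftyContinuousMap.add_apply, ih]
      simp [hsum]
    exact tendsto_nhds_unique h2 h1
  have h0 := y.zero_at_infty'
  rw [Filter.cocompact_eq_cofinite, Nat.cofinite_eq_atTop] at h0
  exact zero_ne_one (tendsto_nhds_unique h0 (tendsto_const_nhds.congr fun i => (hy1 i).symm))

/-- One step of a gliding hump: a pointwise convergent bounded sequence in `c₀` whose tails,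
after applying `D`, have `w` in their closed convex hull. -/
theorem exists_gliding_hump_step {F : Type*} [NormedAddCommGroup F] [NormedSpace ℝ F]
    (D : C₀(ℕ, ℝ) →L[ℝ] F) (f : ℕ → C₀(ℕ, ℝ)) (M : ℝ) (hM : ∀ n, ‖f n‖ ≤ M)
    (z : ℕ → ℝ) (hz : ∀ i, Tendsto (fun n => f n i) atTop (nhds (z i))) (w : F)
    (hw : ∀ m, w ∈ closure (convexHull ℝ ((fun i => D (f i)) '' Set.Ici m)))
    (G : C₀(ℕ, ℝ)) (m : ℕ) (ε : ℝ) (hε : 0 < ε) :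
    ∃ n, m < n ∧ ∃ c : C₀(ℕ, ℝ), ‖D c - w‖ ≤ ε ∧
      ‖G + (f n - c)‖ ≤ max ‖G‖ (2 * M) + ε := by
  have hG := G.zero_at_infty'
  rw [Filter.cocompact_eq_cofinite, Nat.cofinite_eq_atTop, Metric.tendsto_atTop] at hG
  obtain ⟨N, hN⟩ := hG ε hε
  have hev : ∀ᶠ n in atTop, ∀ i ∈ Finset.range N, |f n i - z i| < ε / 2 := by
    rw [Filter.eventually_all_finset]
    intro i _
    have := (Metric.tendsto_nhds.mp (hz i)) (ε / 2) (by positivity)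
    simpa [Real.dist_eq] using this
  obtain ⟨n₀, hn₀⟩ := eventually_atTop.mp hev
  set n := max n₀ (m + 1) with hn
  obtain ⟨y, hy, hyw⟩ := Metric.mem_closure_iff.mp (hw n) ε hε
  have himg : (fun i => D (f i)) '' Set.Ici n = D.toLinearMap '' (f '' Set.Ici n) := by
    rw [Set.image_image]; rfl
  rw [himg, ← LinearMap.image_convexHull] at hy
  obtain ⟨c, hc, rfl⟩ := hy
  have hcM : ‖c‖ ≤ M := by
    have : convexHull ℝ (f '' Set.Ici n) ⊆ Metric.closedBall 0 M := by
      refine convexHull_min ?_ (convex_closedBall _ _)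
      rintro _ ⟨k, -, rfl⟩
      simpa using hM k
    simpa using this hc
  have hci : ∀ i < N, |c i - z i| ≤ ε / 2 := by
    intro i hi
    have hconv : Convex ℝ {c : C₀(ℕ, ℝ) | c i ∈ Metric.closedBall (z i) (ε / 2)} :=
      fun a ha b hb s t hs ht hst => by
        have := convex_closedBall (z i) (ε / 2) ha hb hs ht hst
        simpa using this
    have := convexHull_min ?_ hconv hc
    · simpa [Real.dist_eq] using this
    · rintro _ ⟨k, hk, rfl⟩
      have := hn₀ k ((le_max_left _ _).trans hk) i (Finset.mem_range.mpr hi)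
      simpa [Real.dist_eq] using this.le
  have happ : ∀ (g : C₀(ℕ, ℝ)) (i : ℕ), |g i| ≤ ‖g‖ := fun g i => by
    rw [← ZeroAtInftyContinuousMap.norm_toBCF_eq_norm]
    exact BoundedContinuousFunction.norm_coe_le_norm g.toBCF i
  refine ⟨n, by omega, c, ?_, ?_⟩
  · rw [dist_comm, dist_eq_norm] at hyw
    exact hyw.le
  · rw [← ZeroAtInftyContinuousMap.norm_toBCF_eq_norm]
    refine (BoundedContinuousFunction.norm_le (by positivity)).mpr fun i => ?_
    change |G i + (f n i - c i)| ≤ _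
    have h1 := happ G i
    have h2 := (happ (f n) i).trans (hM n)
    have h3 := (happ c i).trans hcM
    have h4 := le_max_left ‖G‖ (2 * M)
    have h5 := le_max_right ‖G‖ (2 * M)
    rw [abs_le] at h1 h2 h3 ⊢
    by_cases hi : i < N
    · have h6 := hci i hi
      have h7 := hn₀ n (le_max_left _ _) i (Finset.mem_range.mpr hi)
      rw [abs_le] at h6
      rw [abs_lt] at h7
      constructor <;> linarith
    · have h6 : |G i| < ε := by simpa [Real.dist_eq] using hN i (not_lt.mp hi)
      rw [abs_lt] at h6
      constructor <;> linarith

/-- An operator factoring through `c₀` is Banach–Saks as soon as the tails of the image of every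
bounded sequence have closed convex hulls with a common point. -/
theorem banachSaks_of_factorsThrough_zeroAtInfty {E F : Type*} [NormedAddCommGroup E]
    [NormedSpace ℝ E] [NormedAddCommGroup F] [NormedSpace ℝ F] (U : E →L[ℝ] F)
    (hU : FactorsThrough U (ContinuousLinearMap.id ℝ C₀(ℕ, ℝ)))
    (hw : ∀ x : ℕ → E, (∃ M : ℝ, ∀ n, ‖x n‖ ≤ M) →
      ∃ w, ∀ m, w ∈ closure (convexHull ℝ ((fun i => U (x i)) '' Set.Ici m))) :
    BanachSaks U := by
  obtain ⟨C, D, hCD⟩ := hU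
  rintro x ⟨M, hM⟩
  have hCM : ∀ n, ‖C (x n)‖ ≤ ‖C‖ * M := fun n => C.le_opNorm_of_le (hM n)
  obtain ⟨ψ, hψ, z, hz⟩ := exists_pointwise_convergent_subseq (fun n i => C (x n) i) (‖C‖ * M)
    fun n i => by
      refine le_trans ?_ (hCM n)
      rw [← ZeroAtInftyContinuousMap.norm_toBCF_eq_norm]
      exact BoundedContinuousFunction.norm_coe_le_norm (C (x n)).toBCF i
  obtain ⟨w, hw⟩ := hw (x ∘ ψ) ⟨M, fun n => hM _⟩
  set f : ℕ → C₀(ℕ, ℝ) := fun n => C (x (ψ n)) with hf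
  have hDf : ∀ n, D (f n) = U (x (ψ n)) := fun n => hCD _
  set B := ‖C‖ * M with hB
  have hB0 : 0 ≤ B := (norm_nonneg _).trans (hCM 0)
  have step := exists_gliding_hump_step D f B (fun n => hCM _) z hz w
    (by simpa only [hDf, Function.comp_apply] using hw)
  choose n hn c hc hG using step
  have hpos : ∀ k : ℕ, (0 : ℝ) < (1 / 2) ^ k := fun k => by positivity
  let s : ℕ → C₀(ℕ, ℝ) × ℕ := fun k => Nat.rec (0, 0) (fun k p =>
    (p.1 + (f (n p.1 p.2 _ (hpos k)) - c p.1 p.2 _ (hpos k)), n p.1 p.2 _ (hpos k))) k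
  have hs : ∀ k, s (k + 1) = ((s k).1 + (f (n (s k).1 (s k).2 _ (hpos k)) -
    c (s k).1 (s k).2 _ (hpos k)), n (s k).1 (s k).2 _ (hpos k)) := fun _ => rfl
  have hGN : ∀ N, ‖(s N).1‖ ≤ 2 * B + ∑ k ∈ Finset.range N, (1 / 2 : ℝ) ^ k := by
    intro N
    induction N with
    | zero => simpa [s] using hB0
    | succ N ih =>
      rw [Finset.sum_range_succ, ← add_assoc, hs]
      refine (hG _ _ _ _).trans (add_le_add_left (max_le ih ?_) _)
      have : (0 : ℝ) ≤ ∑ k ∈ Finset.range N, (1 / 2 : ℝ) ^ k :=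
        Finset.sum_nonneg fun k _ => (hpos k).le
      linarith
  have hsum : ∀ N, ‖∑ k ∈ Finset.range N, D (f (s (k + 1)).2) - (N : ℝ) • w - D (s N).1‖ ≤
      ∑ k ∈ Finset.range N, (1 / 2 : ℝ) ^ k := by
    intro N
    induction N with
    | zero => simp [s]
    | succ N ih =>
      rw [Finset.sum_range_succ, Finset.sum_range_succ]
      refine le_trans (le_of_eq (congrArg norm ?_))
        ((norm_add_le _ _).trans (add_le_add ih (hc (s N).1 (s N).2 _ (hpos N))))
      rw [hs]
      push_cast
      simp only [map_add, map_sub]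
      module
  have hbound : ∀ N : ℕ, ‖∑ k ∈ Finset.range N, U (x (ψ (s (k + 1)).2)) - (N : ℝ) • w‖ ≤
      ‖D‖ * (2 * B + 2) + 2 := by
    intro N
    have h2 : ∑ k ∈ Finset.range N, (1 / 2 : ℝ) ^ k ≤ 2 := sum_geometric_two_le N
    have h3 : ‖D (s N).1‖ ≤ ‖D‖ * (2 * B + 2) := D.le_opNorm_of_le (by linarith [hGN N])
    have h4 := norm_add_le (∑ k ∈ Finset.range N, D (f (s (k + 1)).2) - (N : ℝ) • w - D (s N).1)
      (D (s N).1)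
    rw [sub_add_cancel] at h4
    simp only [hDf] at h4
    have h5 := hsum N
    simp only [hDf] at h5
    linarith
  refine ⟨fun k => ψ (s (k + 1)).2, hψ.comp (strictMono_nat_of_lt_succ fun k => hn _ _ _ _),
    w, ?_⟩
  rw [tendsto_iff_norm_sub_tendsto_zero]
  have hlim : Tendsto (fun N : ℕ => (‖D‖ * (2 * B + 2) + 2) / (N : ℝ)) atTop (nhds 0) :=
    tendsto_const_div_atTop_nhds_zero_nat _
  refine squeeze_zero' (Eventually.of_forall fun _ => norm_nonneg _) ?_ hlim
  filter_upwards [eventually_gt_atTop 0] with N hN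
  have hN' : (0 : ℝ) < N := Nat.cast_pos.mpr hN
  rw [le_div_iff₀ hN']
  refine le_trans (le_of_eq ?_) (hbound N)
  rw [mul_comm, ← Real.norm_of_nonneg hN'.le, ← norm_smul, smul_sub, smul_smul,
    Real.norm_of_nonneg hN'.le, mul_inv_cancel₀ hN'.ne', one_smul]

/-! ### The Schreier operator -/

/-- The Schreier family: finite sets `A` with `|A| ≤ min A`. -/
abbrev SchreierSet : Type := {A : Finset ℕ // ∀ i ∈ A, A.card ≤ i}

theorem hasSum_abs_lp_one (u : lp (fun _ : ℕ => ℝ) 1) : HasSum (fun i => |u i|) ‖u‖ := by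
  simpa using lp.hasSum_norm (p := 1) (by norm_num) u

/-- The operator from `ℓ₁` to the bounded functions on the Schreier family which sums a sequence
over the members of the family. -/
noncomputable def schreierOperator :
    lp (fun _ : ℕ => ℝ) 1 →L[ℝ] lp (fun _ : SchreierSet => ℝ) ∞ :=
  LinearMap.mkContinuous
    { toFun := fun v => ⟨fun A => ∑ i ∈ A.1, v i, memℓp_infty ⟨‖v‖, by
        rintro _ ⟨A, rfl⟩
        exact (norm_sum_le _ _).trans
          (sum_le_hasSum _ (fun _ _ => abs_nonneg _) (hasSum_abs_lp_one v))⟩⟩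
      map_add' := fun u v => by
        ext A
        exact Finset.sum_add_distrib
      map_smul' := fun r v => by
        ext A
        simp [Finset.mul_sum] }
    1 fun v => by
      rw [one_mul]
      refine lp.norm_le_of_forall_le (norm_nonneg _) fun A => ?_
      exact (norm_sum_le _ _).trans
        (sum_le_hasSum _ (fun _ _ => abs_nonneg _) (hasSum_abs_lp_one v))

theorem schreierOperator_apply (v : lp (fun _ : ℕ => ℝ) 1) (A : SchreierSet) :
    schreierOperator v A = ∑ i ∈ A.1, v i := rfl

theorem not_banachSaks_schreierOperator : ¬ BanachSaks schreierOperator := by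
  intro h
  obtain ⟨φ, hφ, y, hy⟩ := h (fun n => lp.single 1 n (1 : ℝ)) ⟨1, fun n => by
    simp [lp.norm_single]⟩
  set S : ℕ → lp (fun _ : SchreierSet => ℝ) ∞ := fun N =>
    (N : ℝ)⁻¹ • ∑ k ∈ Finset.range N, schreierOperator (lp.single 1 (φ k) (1 : ℝ)) with hS
  have hSA : ∀ N A, S N A =
      (N : ℝ)⁻¹ * ∑ k ∈ Finset.range N, if φ k ∈ A.1 then (1 : ℝ) else 0 := by
    intro N A
    simp only [hS, ← map_sum, lp.coeFn_smul, Pi.smul_apply, smul_eq_mul, schreierOperator_apply]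
    congr 1
    simp only [lp.coeFn_sum, Finset.sum_apply, lp.coeFn_single]
    rw [Finset.sum_comm]
    refine Finset.sum_congr rfl fun k _ => ?_
    simp [Pi.single_apply]
  have hev : ∀ A, Tendsto (fun N => S N A) atTop (nhds (y A)) := fun A => by
    rw [tendsto_iff_norm_sub_tendsto_zero] at hy ⊢
    exact squeeze_zero (fun _ => norm_nonneg _)
      (fun N => lp.norm_apply_le_norm ENNReal.top_ne_zero (S N - y) A) hy
  have hy0 : y = 0 := by
    ext A
    refine tendsto_nhds_unique (hev A) ?_
    simp only [hSA]
    refine Tendsto.cesaro (tendsto_const_nhds.congr' ?_)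
    filter_upwards [eventually_gt_atTop (A.1.sup id)] with k hk
    rw [if_neg]
    · rfl
    · intro hmem
      exact absurd (Finset.le_sup (f := id) hmem) (not_le.mpr (hk.trans_le (hφ.id_le k)))
  subst hy0
  obtain ⟨N₀, hN₀⟩ := Metric.tendsto_atTop.mp hy (1 / 2) (by norm_num)
  set N := N₀ + 1 with hN
  have hlt := hN₀ (2 * N) (by omega)
  rw [dist_zero_right] at hlt
  let A : SchreierSet := ⟨(Finset.Ico N (2 * N)).image φ, by
    intro i hi
    obtain ⟨k, hk, rfl⟩ := Finset.mem_image.mp hi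
    refine Finset.card_image_le.trans ?_
    rw [Nat.card_Ico]
    have := hφ.id_le k
    have := (Finset.mem_Ico.mp hk).1
    simp only [id] at *
    omega⟩
  have hA := (lp.norm_apply_le_norm ENNReal.top_ne_zero (S (2 * N)) A).trans_lt hlt
  rw [hSA] at hA
  have hge : (N : ℝ) ≤ ∑ k ∈ Finset.range (2 * N), if φ k ∈ A.1 then (1 : ℝ) else 0 := by
    calc (N : ℝ) = ∑ k ∈ Finset.Ico N (2 * N), (1 : ℝ) := by
          simp [two_mul]
      _ ≤ ∑ k ∈ Finset.Ico N (2 * N), if φ k ∈ A.1 then (1 : ℝ) else 0 := by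
          refine Finset.sum_le_sum fun k hk => ?_
          rw [if_pos (Finset.mem_image_of_mem φ hk)]
      _ ≤ _ := by
          refine Finset.sum_le_sum_of_subset_of_nonneg (fun k hk => ?_) fun k _ _ => ?_
          · exact Finset.mem_range.mpr (Finset.mem_Ico.mp hk).2
          · split_ifs <;> norm_num
  have hNpos : (0 : ℝ) < N := by positivity
  have hle := (le_abs_self _).trans_lt hA
  rw [inv_mul_lt_iff₀ (by push_cast; positivity)] at hle
  push_cast at hle
  linarith

/-- If a functional is bounded away from zero on infinitely many images of unit vectors, it is
unbounded on finite combinations of them with bounded Schreier norm. -/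
theorem exists_schreierOperator_bounded_large
    (g : lp (fun _ : ℕ => ℝ) 1 →L[ℝ] ℝ) (δ : ℝ)
    (hinf : {i | δ ≤ |g (lp.single 1 i (1 : ℝ))|}.Infinite) (K : ℕ) :
    ∀ L : ℕ, 0 < L → ∃ v : lp (fun _ : ℕ => ℝ) 1, δ * K ≤ g v ∧
      (∀ i, |v i| ≤ (L : ℝ)⁻¹) ∧ ∀ A : SchreierSet, ∑ i ∈ A.1, |v i| ≤ 2 := by
  induction K with
  | zero => exact fun L _ => ⟨0, by simp, by simp, by simp⟩
  | succ K ih =>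
    intro L hL
    obtain ⟨B, hB, hcard⟩ := hinf.exists_subset_card_eq (2 * L)
    obtain ⟨v, hgv, hvi, hvA⟩ := ih (max (2 * L) (B.sup id)) (by omega)
    set a : ℕ → ℝ := fun i => SignType.sign (g (lp.single 1 i (1 : ℝ))) with ha
    have ha1 : ∀ i, |a i| ≤ 1 := by
      intro i
      rcases lt_trichotomy (g (lp.single 1 i (1 : ℝ))) 0 with h | h | h <;> simp [ha, h]
    set x : lp (fun _ : ℕ => ℝ) 1 :=
      ((2 * L : ℕ) : ℝ)⁻¹ • ∑ i ∈ B, a i • lp.single 1 i (1 : ℝ) with hx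
    have hL' : (0 : ℝ) < (2 * L : ℕ) := by exact_mod_cast (by omega : 0 < 2 * L)
    have hLr : (0 : ℝ) < L := by exact_mod_cast hL
    have hxi : ∀ i, x i = if i ∈ B then ((2 * L : ℕ) : ℝ)⁻¹ * a i else 0 := by
      intro i
      simp only [hx, lp.coeFn_smul, lp.coeFn_sum, Pi.smul_apply, Finset.sum_apply,
        lp.coeFn_single, smul_eq_mul]
      simp [Pi.single_apply]
    have hxabs : ∀ i, |x i| ≤ if i ∈ B then ((2 * L : ℕ) : ℝ)⁻¹ else 0 := by
      intro i
      rw [hxi]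
      split_ifs with h
      · rw [abs_mul, abs_of_pos (inv_pos.mpr hL')]
        exact mul_le_of_le_one_right (inv_pos.mpr hL').le (ha1 i)
      · simp
    have hxabs' : ∀ i, |x i| ≤ ((2 * L : ℕ) : ℝ)⁻¹ := fun i => (hxabs i).trans (by
      split_ifs
      · exact le_rfl
      · exact (inv_pos.mpr hL').le)
    refine ⟨v + x, ?_, fun i => ?_, fun A => ?_⟩
    · have hgx : δ ≤ g x := by
        have : ∑ i ∈ B, δ ≤ ∑ i ∈ B, a i * g (lp.single 1 i (1 : ℝ)) := by
          refine Finset.sum_le_sum fun i hi => ?_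
          have : δ ≤ |g (lp.single 1 i (1 : ℝ))| := hB hi
          rwa [ha, sign_mul_self]
        rw [Finset.sum_const, hcard, nsmul_eq_mul] at this
        rw [hx, map_smul, map_sum, smul_eq_mul, le_inv_mul_iff₀ hL']
        simpa only [map_smul, smul_eq_mul] using this
      rw [map_add]
      push_cast
      linarith
    · have h1 := hvi i
      have h2 : ((max (2 * L) (B.sup id) : ℕ) : ℝ)⁻¹ ≤ ((2 * L : ℕ) : ℝ)⁻¹ :=
        inv_anti₀ hL' (by exact_mod_cast le_max_left _ _)
      have h3 := hxabs' i
      have h4 : (L : ℝ)⁻¹ = ((2 * L : ℕ) : ℝ)⁻¹ + ((2 * L : ℕ) : ℝ)⁻¹ := by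
        push_cast
        field_simp
        norm_num
      have h5 := abs_add_le (v i) (x i)
      rw [lp.coeFn_add, Pi.add_apply]
      linarith
    · have htri : ∑ i ∈ A.1, |(v + x) i| ≤ ∑ i ∈ A.1, |v i| + ∑ i ∈ A.1, |x i| := by
        rw [← Finset.sum_add_distrib]
        exact Finset.sum_le_sum fun i _ => abs_add_le (v i) (x i)
      by_cases hAB : ∃ j ∈ A.1, j ∈ B
      · obtain ⟨j, hjA, hjB⟩ := hAB
        have hx1 : ∑ i ∈ A.1, |x i| ≤ 1 := by
          refine (Finset.sum_le_sum fun i _ => hxabs i).trans ?_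
          rw [← Finset.sum_filter, Finset.sum_const, nsmul_eq_mul]
          rw [← div_eq_mul_inv, div_le_one hL']
          norm_cast
          rw [← hcard]
          exact Finset.card_le_card fun i hi => (Finset.mem_filter.mp hi).2
        have hv1 : ∑ i ∈ A.1, |v i| ≤ 1 := by
          refine (Finset.sum_le_sum fun i _ => hvi i).trans ?_
          rw [Finset.sum_const, nsmul_eq_mul, ← div_eq_mul_inv, div_le_one (by positivity)]
          have h1 := A.2 j hjA
          have h2 : j ≤ B.sup id := Finset.le_sup (f := id) hjB
          exact_mod_cast (h1.trans h2).trans (le_max_right _ _)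
        linarith
      · have hx0 : ∑ i ∈ A.1, |x i| = 0 := by
          refine Finset.sum_eq_zero fun i hi => ?_
          rw [hxi, if_neg fun h => hAB ⟨i, hi, h⟩, abs_zero]
        linarith [hvA A]

/-- The unit vectors are mapped to a weakly null sequence by the Schreier operator. -/
theorem tendsto_apply_schreierOperator_single
    (f : lp (fun _ : SchreierSet => ℝ) ∞ →L[ℝ] ℝ) :
    Tendsto (fun i => f (schreierOperator (lp.single 1 i (1 : ℝ)))) atTop (nhds 0) := by
  rw [Metric.tendsto_atTop]
  by_contra! hcon
  obtain ⟨δ, hδ, hcon⟩ := hcon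
  have hinf : {i | δ ≤ |(f.comp schreierOperator) (lp.single 1 i (1 : ℝ))|}.Infinite := by
    refine Set.infinite_of_forall_exists_gt fun n => ?_
    obtain ⟨i, hi, h⟩ := hcon (n + 1)
    exact ⟨i, by simpa [Real.dist_eq] using h, by omega⟩
  obtain ⟨K, hK⟩ := exists_nat_gt (‖f‖ * 2 / δ)
  obtain ⟨v, hv, -, hA⟩ := exists_schreierOperator_bounded_large _ δ hinf K 1 one_pos
  have hnorm : ‖schreierOperator v‖ ≤ 2 :=
    lp.norm_le_of_forall_le (by norm_num) fun A => (norm_sum_le _ _).trans (hA A)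
  have h1 : f (schreierOperator v) ≤ ‖f‖ * 2 := (le_abs_self _).trans (f.le_opNorm_of_le hnorm)
  rw [div_lt_iff₀ hδ] at hK
  have h2 : δ * K ≤ f (schreierOperator v) := hv
  linarith

/-- A functional on `ℓ₁` represented by a null sequence sends bounded pointwise null sequences to
null sequences. -/
theorem tendsto_apply_of_pointwise_null (g : lp (fun _ : ℕ => ℝ) 1 →L[ℝ] ℝ)
    (hg : Tendsto (fun i => g (lp.single 1 i (1 : ℝ))) atTop (nhds 0))
    (u : ℕ → lp (fun _ : ℕ => ℝ) 1) (M : ℝ) (hM : ∀ n, ‖u n‖ ≤ M)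
    (hu : ∀ i, Tendsto (fun n => u n i) atTop (nhds 0)) :
    Tendsto (fun n => g (u n)) atTop (nhds 0) := by
  have hM0 : 0 ≤ M := (norm_nonneg _).trans (hM 0)
  have hsum : ∀ n, HasSum (fun i => u n i * g (lp.single 1 i (1 : ℝ))) (g (u n)) := by
    intro n
    have h := (lp.hasSum_single (p := 1) (by norm_num) (u n)).mapL g
    convert h using 2 with i
    rw [← smul_eq_mul, ← map_smul, ← lp.single_smul, smul_eq_mul, mul_one]
  rw [Metric.tendsto_atTop]
  intro ε hε
  set η := ε / (2 * (M + 1)) with hη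
  have hη0 : 0 < η := by positivity
  obtain ⟨N, hN⟩ := Metric.tendsto_atTop.mp hg η hη0
  have hfin : Tendsto (fun n => ∑ i ∈ Finset.range N, |u n i * g (lp.single 1 i (1 : ℝ))|)
      atTop (nhds 0) := by
    rw [← Finset.sum_const_zero (s := Finset.range N)]
    refine tendsto_finsetSum _ fun i _ => ?_
    simpa using ((hu i).mul_const (g (lp.single 1 i (1 : ℝ)))).abs
  obtain ⟨n₀, hn₀⟩ := Metric.tendsto_atTop.mp hfin (ε / 2) (by positivity)
  refine ⟨n₀, fun n hn => ?_⟩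
  have hF : HasSum (fun i => if i ∈ Finset.range N then
      |u n i * g (lp.single 1 i (1 : ℝ))| else 0)
      (∑ i ∈ Finset.range N, |u n i * g (lp.single 1 i (1 : ℝ))|) := by
    rw [← Finset.sum_congr rfl fun i hi => if_pos hi]
    exact hasSum_sum_of_ne_finset_zero fun i hi => if_neg hi
  have hle := (hsum n).norm_le_of_bounded (hF.add ((hasSum_abs_lp_one (u n)).mul_left η))
    fun i => by
      split_ifs with hi
      · have : 0 ≤ η * |u n i| := by positivity
        rw [Real.norm_eq_abs]
        linarith
      · have h1 := hN i (by simpa using hi)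
        rw [dist_zero_right, Real.norm_eq_abs] at h1
        rw [Real.norm_eq_abs, abs_mul, zero_add, mul_comm]
        exact mul_le_mul_of_nonneg_right h1.le (abs_nonneg _)
  have h1 := hn₀ n hn
  rw [dist_zero_right] at h1
  replace h1 := (le_abs_self _).trans_lt h1
  have h2 : η * ‖u n‖ < ε / 2 := by
    calc η * ‖u n‖ ≤ η * M := mul_le_mul_of_nonneg_left (hM n) hη0.le
      _ < η * (M + 1) := mul_lt_mul_of_pos_left (by linarith) hη0
      _ = ε / 2 := by rw [hη]; field_simp
  rw [dist_zero_right]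
  linarith

/-- The tails of the image of a bounded sequence under the Schreier operator have closed convex
hulls with a common point. -/
theorem schreierOperator_exists_mem_closure_convexHull (v : ℕ → lp (fun _ : ℕ => ℝ) 1)
    (hv : ∃ M : ℝ, ∀ n, ‖v n‖ ≤ M) :
    ∃ w, ∀ m, w ∈ closure (convexHull ℝ ((fun i => schreierOperator (v i)) '' Set.Ici m)) := by
  obtain ⟨M, hM⟩ := hv
  obtain ⟨φ, hφ, z, hz⟩ := exists_pointwise_convergent_subseq (fun n i => v n i) M
    fun n i => (lp.norm_apply_le_norm one_ne_zero (v n) i).trans (hM n)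
  have hzmem : Memℓp z 1 := lp.memℓp_of_tendsto (F := fun n => v (φ n)) (l := atTop)
    (isBounded_iff_forall_norm_le.mpr ⟨M, by rintro _ ⟨n, rfl⟩; exact hM _⟩)
    (tendsto_pi_nhds.mpr hz)
  set Z : lp (fun _ : ℕ => ℝ) 1 := ⟨z, hzmem⟩ with hZ
  refine ⟨schreierOperator Z, fun m => ?_⟩
  by_contra hnot
  obtain ⟨f, c, hfc, hc⟩ := geometric_hahn_banach_point_closed
    (convex_convexHull ℝ _).closure isClosed_closure hnot
  have hnull := tendsto_apply_of_pointwise_null (f.comp schreierOperator)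
    (tendsto_apply_schreierOperator_single f) (fun n => v (φ n) - Z) (M + ‖Z‖)
    (fun n => (norm_sub_le _ _).trans (add_le_add_left (hM _) _)) fun i => by
      have h := (hz i).sub_const (z i)
      rwa [sub_self] at h
  have hlim : Tendsto (fun n => f (schreierOperator (v (φ n)))) atTop
      (nhds (f (schreierOperator Z))) := by
    rw [← tendsto_sub_nhds_zero_iff]
    simpa using hnull
  refine absurd (ge_of_tendsto hlim ?_) (not_le.mpr hfc)
  filter_upwards [eventually_ge_atTop m] with n hn
  exact (hc _ (subset_closure (subset_convexHull ℝ _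
    ⟨φ n, Set.mem_Ici.mpr (hn.trans (hφ.id_le n)), rfl⟩))).le

theorem statement5 :
    ¬ ∃ (E F : BanachSp) (U : E.carrier →L[ℝ] F.carrier),
      ¬ BanachSaks U ∧
        ∀ (Z W : BanachSp) (T : Z.carrier →L[ℝ] W.carrier),
          ¬ BanachSaks T → FactorsThrough U T := by
  rintro ⟨E, F, U, hU, huniv⟩
  obtain ⟨C, D, hCD⟩ := huniv ⟨lp (fun _ : ℕ => ℝ) 1⟩ ⟨lp (fun _ : SchreierSet => ℝ) ∞⟩
    schreierOperator not_banachSaks_schreierOperator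
  refine hU (banachSaks_of_factorsThrough_zeroAtInfty U
    (huniv ⟨C₀(ℕ, ℝ)⟩ ⟨C₀(ℕ, ℝ)⟩ _ not_banachSaks_id_zeroAtInfty) ?_)
  rintro x ⟨M, hM⟩
  obtain ⟨w, hw⟩ := schreierOperator_exists_mem_closure_convexHull (fun n => C (x n))
    ⟨‖C‖ * M, fun n => C.le_opNorm_of_le (hM n)⟩
  refine ⟨D w, fun m => ?_⟩
  have h := image_closure_subset_closure_image D.continuous (Set.mem_image_of_mem D (hw m))
  have himg : (fun i => U (x i)) '' Set.Ici m =
      D.toLinearMap '' ((fun i => schreierOperator (C (x i))) '' Set.Ici m) := by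
    rw [Set.image_image]
    exact Set.image_congr fun i _ => (hCD (x i)).symm
  rw [himg, ← LinearMap.image_convexHull]
  exact h
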